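/- Let K be an irreducible kernel on a countable set X with all convolution powers finite, let t > 0, and fix o ∈ X. Then the set B(K,t) := { f : X → [0,∞) : Σ_{y∈X} k(x,y) f(y) ≤ t · f(x) for all x ∈ X, and f(o) = 1 } is compact in the topology of pointwise convergence on the product space [0,∞)^X. -/

import Mathlib

open Filter
open scoped ENNReal NNReal

/-- Convolution powers of a kernel: `k^(0)(x,y) = 1` if `x = y` and `0` otherwise, and
`k^(n+1)(x,y) = Σ_z k^(n)(x,z) * k(z,y)`. -/
noncomputable def kpow {X : Type*} [DecidableEq X] (k : X → X → ℝ≥0∞) : ℕ → X → X → ℝ≥0∞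
  | 0 => fun x y => if x = y then 1 else 0
  | n + 1 => fun x y => ∑' z, kpow k n x z * k z y

/-- A kernel is irreducible if for all `x, y` there is `l ≥ 1` with `k^(l)(x,y) > 0`. -/
def KIrred {X : Type*} [DecidableEq X] (k : X → X → ℝ≥0∞) : Prop :=
  ∀ x y, ∃ l, 1 ≤ l ∧ 0 < kpow k l x y

/-- The Green function `G(x,y|z) = Σ_n k^(n)(x,y) * zⁿ`. -/
noncomputable def green {X : Type*} [DecidableEq X] (k : X → X → ℝ≥0∞) (x y : X)
    (z : ℝ≥0∞) : ℝ≥0∞ :=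
  ∑' n, kpow k n x y * z ^ n

/-- The radius of convergence of the Green function `G(x,y|·)`: the supremum of the set of
`z` at which the series converges (is finite). -/
noncomputable def convRadius {X : Type*} [DecidableEq X] (k : X → X → ℝ≥0∞) (x y : X) : ℝ≥0∞ :=
  sSup {z : ℝ≥0∞ | green k x y z ≠ ⊤}

/-- `limsup_n (k^(n)(x,y))^{1/n}`. -/
noncomputable def rhoAt {X : Type*} [DecidableEq X] (k : X → X → ℝ≥0∞) (x y : X) : ℝ≥0∞ :=
  Filter.limsup (fun n : ℕ => (kpow k n x y) ^ (1 / (n : ℝ))) Filter.atTop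

/-- The first convolution power is the kernel itself. -/
lemma kpow_one {X : Type*} [DecidableEq X] (k : X → X → ℝ≥0∞) : kpow k 1 = k := by
  funext x y
  simp only [kpow]
  rw [tsum_eq_single x (fun z hz => by simp [Ne.symm hz])]
  simp

/-- A `t`-superharmonic function for `k` is `t ^ n`-superharmonic for the `n`-th convolution
power. -/
lemma tsum_kpow_mul_le {X : Type*} [DecidableEq X] {k : X → X → ℝ≥0∞} {t : ℝ≥0∞}
    {f : X → ℝ≥0∞} (hf : ∀ x, ∑' y, k x y * f y ≤ t * f x) (n : ℕ) (x : X) :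
    ∑' y, kpow k n x y * f y ≤ t ^ n * f x := by
  induction n with
  | zero =>
    simp only [kpow]
    rw [tsum_eq_single x (fun z hz => by simp [Ne.symm hz])]
    simp
  | succ n ih =>
    calc ∑' y, kpow k (n + 1) x y * f y
        = ∑' y, ∑' z, kpow k n x z * (k z y * f y) := by
          simp only [kpow, ← ENNReal.tsum_mul_right, mul_assoc]
      _ = ∑' z, kpow k n x z * ∑' y, k z y * f y := by
          rw [ENNReal.tsum_comm]
          simp only [ENNReal.tsum_mul_left]
      _ ≤ ∑' z, kpow k n x z * (t * f z) := by
          gcongr with z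
          exact hf z
      _ = t * ∑' z, kpow k n x z * f z := by
          simp only [← ENNReal.tsum_mul_left, mul_left_comm]
      _ ≤ t * (t ^ n * f x) := by gcongr
      _ = t ^ (n + 1) * f x := by ring

/-- For a kernel with finite entries, the set of `t`-superharmonic functions is closed under
pointwise convergence. -/
lemma isClosed_setOf_superharmonic {X : Type*} {k : X → X → ℝ≥0∞} (hk : ∀ x y, k x y ≠ ⊤)
    (t : ℝ≥0) :
    IsClosed {f : X → ℝ≥0 |
      ∀ x, ∑' y, k x y * (f y : ℝ≥0∞) ≤ (t : ℝ≥0∞) * (f x : ℝ≥0∞)} := by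
  have hcont (a : ℝ≥0∞) (ha : a ≠ ⊤) (y : X) :
      Continuous fun f : X → ℝ≥0 => a * (f y : ℝ≥0∞) :=
    (ENNReal.continuous_const_mul ha).comp
      (ENNReal.continuous_coe.comp (continuous_apply y))
  simp only [ENNReal.tsum_eq_iSup_sum, iSup_le_iff, Set.ofPred_forall]
  exact isClosed_iInter fun x => isClosed_iInter fun s =>
    isClosed_le (continuous_finsetSum s fun y _ => hcont _ (hk x y) y)
      (hcont _ ENNReal.coe_ne_top x)

/-- For an irreducible kernel with finite convolution powers, `t > 0` and a base point `o`,
the base `B(K,t)` of the cone of nonnegative `t`-superharmonic functions normalized by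
`f(o) = 1` is compact in the topology of pointwise convergence on `[0,∞)^X`. -/
theorem base_superharmonic_compact {X : Type*} [Countable X] [DecidableEq X] (k : X → X → ℝ≥0∞)
    (hfin : ∀ n x y, kpow k n x y ≠ ⊤) (hirr : KIrred k)
    (t : ℝ≥0) (ht : 0 < t) (o : X) :
    IsCompact {f : X → ℝ≥0 |
      (∀ x, ∑' y, k x y * (f y : ℝ≥0∞) ≤ (t : ℝ≥0∞) * (f x : ℝ≥0∞)) ∧ f o = 1} := by
  have hk : ∀ x y, k x y ≠ ⊤ := by simpa only [kpow_one] using hfin 1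
  choose l _ hpos using hirr o
  refine (isCompact_univ_pi fun y =>
    isCompact_Icc (a := (0 : ℝ≥0))
      (b := ((t : ℝ≥0∞) ^ l y / kpow k (l y) o y).toNNReal)).of_isClosed_subset
    ((isClosed_setOf_superharmonic hk t).inter
      (isClosed_eq (continuous_apply o) continuous_const)) ?_
  rintro f ⟨hf, hfo⟩ y -
  refine ⟨zero_le, ?_⟩
  have hle : kpow k (l y) o y * f y ≤ (t : ℝ≥0∞) ^ l y := by
    simpa [hfo] using (ENNReal.le_tsum y).trans (tsum_kpow_mul_le hf (l y) o)
  have htop : (t : ℝ≥0∞) ^ l y / kpow k (l y) o y ≠ ⊤ :=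
    ENNReal.div_ne_top (ENNReal.pow_ne_top ENNReal.coe_ne_top) (hpos y).ne'
  rw [← ENNReal.coe_le_coe, ENNReal.coe_toNNReal htop,
    ENNReal.le_div_iff_mul_le (Or.inl (hpos y).ne') (Or.inl (hfin _ _ _)), mul_comm]
  exact hle
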